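/- Let (π,U,H) be a covariant representation of (A,δ) possessing property (*). Then for each k ∈ ℤ the contraction 𝒩_k on C*_0(π(A),U), determined by 𝒩_k(Σ_{m,n} U^{*m} π(a_{mn}) U^n) = Σ_n U^{*n} π(a_n^{(k)}) U^n for matrices {a_{mn}} ∈ M(A), extends uniquely to a bounded linear map 𝒩_k : C*(π(A),U) → B(H), and for every a ∈ C*(π(A),U) the following are equivalent: (i) a = 0; (ii) 𝒩_k(a) = 0 for all k ∈ ℤ; (iii) 𝒩_0(a* a) = 0. -/

import Mathlib

open Filter Topology
open scoped NNReal

noncomputable section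

variable {A : Type*} [CStarAlgebra A]

/-- The underlying set of the matrix algebra `M(A)`: matrices over `A` with finitely many
nonzero entries satisfying the entry condition `a_{ij} ∈ δ^i(1)·A·δ^j(1)`. -/
def MatMem (δ : A →⋆ₙₐ[ℂ] A) (a : ℕ → ℕ → A) : Prop :=
  ({p : ℕ × ℕ | a p.1 p.2 ≠ 0}).Finite ∧
    ∀ i j : ℕ, (⇑δ)^[i] 1 * a i j * (⇑δ)^[j] 1 = a i j

/-- The shift `Λ : Λ(a)_{ij} = δ(a_{i-1,j-1})` for `i, j ≥ 1`, and `0` otherwise. -/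
def lam (δ : A →⋆ₙₐ[ℂ] A) (a : ℕ → ℕ → A) : ℕ → ℕ → A :=
  fun i j => if i = 0 ∨ j = 0 then 0 else δ (a (i - 1) (j - 1))

/-- Ordinary (finitely supported) matrix multiplication. -/
def matMul (a b : ℕ → ℕ → A) : ℕ → ℕ → A := fun i k => ∑ᶠ j : ℕ, a i j * b j k

/-- The convolution multiplication `a ⋆ b = a·Σ_{j≥0} Λ^j(b) + Σ_{j≥1} Λ^j(a)·b`. -/
def conv (δ : A →⋆ₙₐ[ℂ] A) (a b : ℕ → ℕ → A) : ℕ → ℕ → A :=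
  fun i k => (∑ᶠ j : ℕ, matMul a ((lam δ)^[j] b) i k) +
    ∑ᶠ j : ℕ, matMul ((lam δ)^[j + 1] a) b i k

/-- The involution `(a*)_{mn} = (a_{nm})*`. -/
def mstar (a : ℕ → ℕ → A) : ℕ → ℕ → A := fun i j => star (a j i)

/-- The embedding of `A` into `M(A)` at the `(0,0)` entry. -/
def embed (a : A) : ℕ → ℕ → A := fun i j => if i = 0 ∧ j = 0 then a else 0

/-- The matrix `u`, having `δ(1)` at the `(0,1)` entry and zeros elsewhere. -/
def umat (δ : A →⋆ₙₐ[ℂ] A) : ℕ → ℕ → A := fun i j => if i = 0 ∧ j = 1 then δ 1 else 0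

/-- `⋆`-powers of a matrix (`mpow δ x 0` is the matrix unit `embed 1`). -/
def mpow (δ : A →⋆ₙₐ[ℂ] A) (x : ℕ → ℕ → A) : ℕ → ℕ → ℕ → A
  | 0 => embed 1
  | n + 1 => conv δ (mpow δ x n) x

/-- A matrix is `k`-diagonal if all entries away from the `k`-th diagonal vanish. -/
def IsDiag (k : ℤ) (a : ℕ → ℕ → A) : Prop :=
  ∀ i j : ℕ, a i j ≠ 0 → (j : ℤ) - (i : ℤ) = k

/-- The `n`-th entry `a_n^{(k)}` of the `k`-th diagonal of a matrix. -/
def diagEntry (a : ℕ → ℕ → A) (k : ℤ) (n : ℕ) : A :=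
  if 0 ≤ k then a n (n + k.toNat) else a (n + (-k).toNat) n

/-- `N_k` carries the `k`-th diagonal onto the `0`-th diagonal and deletes the rest. -/
def Nmat (a : ℕ → ℕ → A) (k : ℤ) : ℕ → ℕ → A :=
  fun i j => if i = j then diagEntry a k i else 0

variable {H : Type*} [NormedAddCommGroup H] [InnerProductSpace ℂ H] [CompleteSpace H]

/-- `(π, U, H)` is a covariant representation of `(A, δ)`. -/
def IsCovariantRep (δ : A →⋆ₙₐ[ℂ] A) (π : A →⋆ₐ[ℂ] (H →L[ℂ] H)) (U : H →L[ℂ] H) : Prop :=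
  Function.Injective π ∧ U * star U * U = U ∧
    (∀ a : A, U * π a * star U = π (δ a)) ∧
    (∀ a : A, star U * U * π a = π a * (star U * U))

/-- The map `Ψ_{(π,U)} : M(A) → B(H)`, `a ↦ Σ_{m,n} U^{*m} π(a_{mn}) U^n`. -/
def Psi (π : A →⋆ₐ[ℂ] (H →L[ℂ] H)) (U : H →L[ℂ] H) (a : ℕ → ℕ → A) : H →L[ℂ] H :=
  ∑ᶠ (m : ℕ) (n : ℕ), (star U) ^ m * π (a m n) * U ^ n

/-- Property `(*)` of a covariant representation. -/
def PropertyStar (δ : A →⋆ₙₐ[ℂ] A) (π : A →⋆ₐ[ℂ] (H →L[ℂ] H)) (U : H →L[ℂ] H) : Prop :=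
  ∀ a : ℕ → ℕ → A, MatMem δ a →
    ‖∑ᶠ m : ℕ, (star U) ^ m * π (a m m) * U ^ m‖ ≤ ‖Psi π U a‖

/-! ### Graded `C*`-algebras with contractive homogeneous projections -/

section GradedProjections

variable {S : Type*} [CStarAlgebra S]

/-- A grading of a dense `*`-subalgebra of the `C*`-algebra `S` by `ℤ`, together with contractive
linear maps on `S` projecting onto the homogeneous subspaces. -/
structure IsGradedProjection (G : ℤ → Submodule ℂ S) (P : ℤ → S →L[ℂ] S) : Prop where
  one_mem : 1 ∈ G 0
  mul_mem : ∀ {k l x y}, x ∈ G k → y ∈ G l → x * y ∈ G (k + l)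
  star_mem : ∀ {k x}, x ∈ G k → star x ∈ G (-k)
  dense : Dense ((⨆ k, G k : Submodule ℂ S) : Set S)
  apply_same : ∀ {k x}, x ∈ G k → P k x = x
  apply_ne : ∀ {k l x}, x ∈ G l → l ≠ k → P k x = 0
  norm_apply_le : ∀ k x, ‖P k x‖ ≤ ‖x‖

/-- The sum of the homogeneous subspaces of degrees between `-N` and `N`. -/
def gradedBand (G : ℤ → Submodule ℂ S) (N : ℕ) : Submodule ℂ S :=
  Submodule.span ℂ {x | ∃ k : ℤ, |k| ≤ N ∧ x ∈ G k}

lemma gradedBand_mono (G : ℤ → Submodule ℂ S) {M N : ℕ} (h : M ≤ N) :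
    gradedBand G M ≤ gradedBand G N :=
  Submodule.span_mono fun _ ⟨k, hk, hx⟩ => ⟨k, hk.trans (by exact_mod_cast h), hx⟩

lemma exists_mem_gradedBand (G : ℤ → Submodule ℂ S) {x : S} (hx : x ∈ ⨆ k, G k) :
    ∃ N, x ∈ gradedBand G N := by
  induction hx using Submodule.iSup_induction' with
  | mem k x hx => exact ⟨k.natAbs, Submodule.subset_span ⟨k, by simp, hx⟩⟩
  | zero => exact ⟨0, zero_mem _⟩
  | add x y _ _ hx hy =>
    obtain ⟨M, hM⟩ := hx
    obtain ⟨N, hN⟩ := hy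
    exact ⟨max M N, add_mem (gradedBand_mono G (le_max_left _ _) hM)
      (gradedBand_mono G (le_max_right _ _) hN)⟩

/-- A quantity whose `2 ^ j`-th powers are dominated up to a linear factor is dominated. -/
lemma le_of_pow_le_linear_mul_pow {r s : ℝ} (hs : 0 ≤ s) (N : ℕ)
    (h : ∀ j : ℕ, r ^ 2 ^ j ≤ (2 * (N * 2 ^ j : ℕ) + 1) * s ^ 2 ^ j) : r ≤ s := by
  by_contra! hlt
  have hr : 0 < r := hs.trans_lt hlt
  have hq0 : 0 ≤ s / r := div_nonneg hs hr.le
  have hq1 : s / r < 1 := (div_lt_one hr).2 hlt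
  have h1 := tendsto_self_mul_const_pow_of_lt_one hq0 hq1
  have h2 := tendsto_pow_atTop_nhds_zero_of_lt_one hq0 hq1
  have h3 : Tendsto (fun n : ℕ => 2 * N * ((n : ℝ) * (s / r) ^ n) + (s / r) ^ n) atTop (𝓝 0) := by
    simpa using (h1.const_mul (2 * (N : ℝ))).add h2
  have h4 := h3.comp (tendsto_pow_atTop_atTop_of_one_lt (one_lt_two : (1 : ℕ) < 2))
  refine absurd (ge_of_tendsto' h4 (b := 1) fun j => ?_) (by norm_num)
  have hp : 0 < r ^ 2 ^ j := pow_pos hr _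
  have h5 := h j
  rw [← div_le_div_iff_of_pos_right hp, div_self hp.ne', mul_div_assoc, ← div_pow] at h5
  refine h5.trans (le_of_eq ?_)
  simp only [Function.comp_apply]
  push_cast
  ring

namespace IsGradedProjection

variable {G : ℤ → Submodule ℂ S} {P : ℤ → S →L[ℂ] S} (h : IsGradedProjection G P)

include h

lemma apply_mem {x : S} (hx : x ∈ ⨆ k, G k) (k : ℤ) : P k x ∈ G k := by
  induction hx using Submodule.iSup_induction' with
  | mem l x hx =>
    by_cases hl : l = k
    · subst hl; rwa [h.apply_same hx]
    · rw [h.apply_ne hx hl]; exact zero_mem _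
  | zero => simp
  | add x y _ _ hx hy => rw [map_add]; exact add_mem hx hy

lemma sum_apply {N : ℕ} {x : S} (hx : x ∈ gradedBand G N) :
    ∑ k ∈ Finset.Icc (-N : ℤ) N, P k x = x := by
  induction hx using Submodule.span_induction with
  | mem x hx =>
    obtain ⟨k, hk, hx⟩ := hx
    rw [Finset.sum_eq_single_of_mem k (Finset.mem_Icc.2 (abs_le.1 hk))
      fun l _ hl => h.apply_ne hx hl.symm, h.apply_same hx]
  | zero => simp
  | add x y _ _ hx hy => simp only [map_add, Finset.sum_add_distrib, hx, hy]
  | smul c x _ hx => simp only [map_smul, ← Finset.smul_sum, hx]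

lemma mul_mem_band {M N : ℕ} {x y : S} (hx : x ∈ gradedBand G M) (hy : y ∈ gradedBand G N) :
    x * y ∈ gradedBand G (M + N) := by
  have h1 : gradedBand G M * gradedBand G N ≤ gradedBand G (M + N) := by
    rw [gradedBand, gradedBand, Submodule.span_mul_span]
    refine Submodule.span_mono (Set.mul_subset_iff.2 ?_)
    rintro x ⟨k, hk, hx⟩ y ⟨l, hl, hy⟩
    exact ⟨k + l, (abs_add_le k l).trans (by push_cast; exact add_le_add hk hl), h.mul_mem hx hy⟩
  exact h1 (Submodule.mul_mem_mul hx hy)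

lemma pow_mem_band {N : ℕ} {x : S} (hx : x ∈ gradedBand G N) (n : ℕ) :
    x ^ n ∈ gradedBand G (N * n) := by
  induction n with
  | zero => exact Submodule.subset_span ⟨0, by simp, by simpa using h.one_mem⟩
  | succ n ih => rw [pow_succ, mul_add_one]; exact h.mul_mem_band ih hx

lemma star_mem_band {N : ℕ} {x : S} (hx : x ∈ gradedBand G N) : star x ∈ gradedBand G N := by
  induction hx using Submodule.span_induction with
  | mem x hx =>
    obtain ⟨k, hk, hx⟩ := hx
    exact Submodule.subset_span ⟨-k, by rwa [abs_neg], h.star_mem hx⟩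
  | zero => simp
  | add x y _ _ hx hy => rw [star_add]; exact add_mem hx hy
  | smul c x _ hx => rw [star_smul]; exact Submodule.smul_mem _ _ hx

lemma norm_le_of_mem_band {N : ℕ} {x : S} (hx : x ∈ gradedBand G N) {C : ℝ}
    (hC : ∀ k, ‖P k x‖ ≤ C) : ‖x‖ ≤ (2 * N + 1) * C := by
  have hcard : (Finset.Icc (-N : ℤ) N).card = 2 * N + 1 := by rw [Int.card_Icc]; omega
  calc ‖x‖ = ‖∑ k ∈ Finset.Icc (-N : ℤ) N, P k x‖ := by rw [h.sum_apply hx]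
    _ ≤ ∑ k ∈ Finset.Icc (-N : ℤ) N, C := norm_sum_le_of_le _ fun k _ => hC k
    _ = (2 * N + 1) * C := by rw [Finset.sum_const, hcard, nsmul_eq_mul]; push_cast; ring

lemma apply_mul_left {l : ℤ} {w : S} (hw : w ∈ G l) (k : ℤ) (y : S) :
    P k (w * y) = w * P (k - l) y := by
  have hcl : IsClosed {y | P k (w * y) = w * P (k - l) y} :=
    isClosed_eq (by fun_prop) (by fun_prop)
  refine hcl.closure_subset_iff.2 (fun y hy => ?_) (h.dense y)
  simp only [Set.mem_ofPred_eq]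
  induction hy using Submodule.iSup_induction' with
  | mem j y hy =>
    by_cases hj : j = k - l
    · subst hj
      rw [h.apply_same hy, h.apply_same (by simpa using h.mul_mem hw hy)]
    · rw [h.apply_ne hy hj, h.apply_ne (h.mul_mem hw hy) (by omega), mul_zero]
  | zero => simp
  | add x y _ _ hx hy => simp only [mul_add, map_add, hx, hy]

lemma apply_mul_right {l : ℤ} {w : S} (hw : w ∈ G l) (k : ℤ) (y : S) :
    P k (y * w) = P (k - l) y * w := by
  have hcl : IsClosed {y | P k (y * w) = P (k - l) y * w} :=
    isClosed_eq (by fun_prop) (by fun_prop)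
  refine hcl.closure_subset_iff.2 (fun y hy => ?_) (h.dense y)
  simp only [Set.mem_ofPred_eq]
  induction hy using Submodule.iSup_induction' with
  | mem j y hy =>
    by_cases hj : j = k - l
    · subst hj
      rw [h.apply_same hy, h.apply_same (by simpa using h.mul_mem hy hw)]
    · rw [h.apply_ne hy hj, h.apply_ne (h.mul_mem hy hw) (by omega), zero_mul]
  | zero => simp
  | add x y _ _ hx hy => simp only [add_mul, map_add, hx, hy]

lemma apply_mul_eq_zero_of_right {y : S} (hy : ∀ k, P k y = 0) (w : S) (k : ℤ) :
    P k (w * y) = 0 := by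
  have hcl : IsClosed {w | P k (w * y) = 0} := isClosed_eq (by fun_prop) (by fun_prop)
  refine hcl.closure_subset_iff.2 (fun w hw => ?_) (h.dense w)
  simp only [Set.mem_ofPred_eq]
  induction hw using Submodule.iSup_induction' with
  | mem j w hw => rw [h.apply_mul_left hw, hy, mul_zero]
  | zero => simp
  | add x y _ _ hx hy => simp only [add_mul, map_add, hx, hy, add_zero]

lemma apply_mul_eq_zero_of_left {y : S} (hy : ∀ k, P k y = 0) (w : S) (k : ℤ) :
    P k (y * w) = 0 := by
  have hcl : IsClosed {w | P k (y * w) = 0} := isClosed_eq (by fun_prop) (by fun_prop)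
  refine hcl.closure_subset_iff.2 (fun w hw => ?_) (h.dense w)
  simp only [Set.mem_ofPred_eq]
  induction hw using Submodule.iSup_induction' with
  | mem j w hw => rw [h.apply_mul_right hw, hy, zero_mul]
  | zero => simp
  | add x y _ _ hx hy => simp only [mul_add, map_add, hx, hy, add_zero]

lemma apply_pow_sub {y : S} (hy : ∀ k, P k y = 0) (b : S) (n : ℕ) (k : ℤ) :
    P k (b ^ n) = P k ((b - y) ^ n) := by
  rw [← sub_eq_zero, ← map_sub]
  induction n generalizing k with
  | zero => simp
  | succ n ih =>
    have : b ^ (n + 1) - (b - y) ^ (n + 1) = (b ^ n - (b - y) ^ n) * b + (b - y) ^ n * y := by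
      rw [pow_succ, pow_succ]; noncomm_ring
    rw [this, map_add, h.apply_mul_eq_zero_of_left ih, h.apply_mul_eq_zero_of_right hy, add_zero]

lemma norm_le_norm_sub {y : S} (hy : ∀ k, P k y = 0) {N : ℕ} {b : S} (hb : b ∈ gradedBand G N)
    (hsa : IsSelfAdjoint b) : ‖b‖ ≤ ‖b - y‖ := by
  refine le_of_pow_le_linear_mul_pow (norm_nonneg _) N fun j => ?_
  rw [← hsa.norm_pow_two_pow]
  refine h.norm_le_of_mem_band (h.pow_mem_band hb _) fun k => ?_
  rw [h.apply_pow_sub hy]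
  exact (h.norm_apply_le k _).trans (norm_pow_le' _ (by positivity))

/-- An element all of whose homogeneous components vanish is zero. -/
theorem eq_zero_of_apply_eq_zero {y : S} (hy : ∀ k, P k y = 0) : y = 0 := by
  have hz : ∀ k, P k (star y * y) = 0 := h.apply_mul_eq_zero_of_right hy _
  have hcl : IsClosed {x : S | ‖star y * y‖ ≤ 2 * ‖star x * x - star y * y‖} :=
    isClosed_le (by fun_prop) (by fun_prop)
  have key : ‖star y * y‖ ≤ 2 * ‖star y * y - star y * y‖ := by
    refine hcl.closure_subset_iff.2 (fun x hx => ?_) (h.dense y)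
    obtain ⟨N, hN⟩ := exists_mem_gradedBand G hx
    have h1 := h.norm_le_norm_sub hz (h.mul_mem_band (h.star_mem_band hN) hN)
      (IsSelfAdjoint.star_mul_self x)
    have h2 := norm_sub_le (star x * x) (star x * x - star y * y)
    rw [sub_sub_cancel] at h2
    simp only [Set.mem_ofPred_eq]
    linarith
  rw [sub_self, norm_zero, mul_zero, norm_le_zero_iff] at key
  exact (CStarRing.star_mul_self_eq_zero_iff y).1 key

/-- Each homogeneous component is dominated by the degree zero component of `y* y`. -/
theorem norm_apply_sq_le (k : ℤ) (y : S) : ‖P k y‖ ^ 2 ≤ ‖P 0 (star y * y)‖ := by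
  have hcl : IsClosed {y : S | ‖P k y‖ ^ 2 ≤ ‖P 0 (star y * y)‖} :=
    isClosed_le (by fun_prop) (by fun_prop)
  refine hcl.closure_subset_iff.2 (fun y hy => ?_) (h.dense y)
  simp only [Set.mem_ofPred_eq]
  obtain ⟨M, hM⟩ := exists_mem_gradedBand G hy
  set N := max M k.natAbs with hN
  have hyN := gradedBand_mono G (le_max_left M k.natAbs) hM
  have hk : k ∈ Finset.Icc (-N : ℤ) N := by rw [Finset.mem_Icc]; omega
  have hsum : P 0 (star y * y) = ∑ i ∈ Finset.Icc (-N : ℤ) N, star (P i y) * P i y := by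
    conv_lhs => rw [← h.sum_apply hyN, star_sum, Finset.sum_mul_sum, map_sum]
    refine Finset.sum_congr rfl fun i hi => ?_
    have hi' := h.star_mem (h.apply_mem hy i)
    rw [map_sum, Finset.sum_eq_single_of_mem i hi fun j _ hj =>
      h.apply_ne (h.mul_mem hi' (h.apply_mem hy j)) (by omega)]
    exact h.apply_same (by simpa using h.mul_mem hi' (h.apply_mem hy i))
  let _ := CStarAlgebra.spectralOrder S
  have := CStarAlgebra.spectralOrderedRing S
  rw [sq, ← CStarRing.norm_star_mul_self, hsum]
  exact CStarAlgebra.norm_le_norm_of_nonneg_of_le (star_mul_self_nonneg _)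
    (Finset.single_le_sum (f := fun i => star (P i y) * P i y)
      (fun i _ => star_mul_self_nonneg _) hk)

end IsGradedProjection

end GradedProjections

/-! ### The monomials `U^{*m} π(a) U^n` -/

section Monomials

variable {B : Type*} [CStarAlgebra B]

/-- The algebraic relations of a covariant representation in an arbitrary `C*`-algebra. -/
structure IsCovariantPair (δ : A →⋆ₙₐ[ℂ] A) (π : A →⋆ₐ[ℂ] B) (U : B) : Prop where
  mul_star_mul : U * star U * U = U
  conj : ∀ a, U * π a * star U = π (δ a)
  commute : ∀ a, star U * U * π a = π a * (star U * U)

/-- The monomial `U^{*m} π(a) U^n`. -/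
def covMonomial (π : A →⋆ₐ[ℂ] B) (U : B) (m : ℕ) (a : A) (n : ℕ) : B :=
  star U ^ m * π a * U ^ n

/-- The span of the monomials `U^{*m} π(a) U^n` with `n - m = k`. -/
def covDegree (π : A →⋆ₐ[ℂ] B) (U : B) (k : ℤ) : Submodule ℂ B :=
  Submodule.span ℂ {x | ∃ (m : ℕ) (a : A) (n : ℕ), (n : ℤ) - m = k ∧ x = covMonomial π U m a n}

lemma covMonomial_mem (π : A →⋆ₐ[ℂ] B) (U : B) {m n : ℕ} {k : ℤ} (hk : (n : ℤ) - m = k) (a : A) :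
    covMonomial π U m a n ∈ covDegree π U k :=
  Submodule.subset_span ⟨m, a, n, hk, rfl⟩

lemma star_covMonomial (π : A →⋆ₐ[ℂ] B) (U : B) (m : ℕ) (a : A) (n : ℕ) :
    star (covMonomial π U m a n) = covMonomial π U n (star a) m := by
  simp only [covMonomial, star_mul, star_pow, star_star, map_star, mul_assoc]

@[simp] lemma covMonomial_zero (π : A →⋆ₐ[ℂ] B) (U : B) (m n : ℕ) :
    covMonomial π U m 0 n = 0 := by simp [covMonomial]

lemma pow_mem_covDegree (π : A →⋆ₐ[ℂ] B) (U : B) (n : ℕ) : U ^ n ∈ covDegree π U n := by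
  simpa [covMonomial] using covMonomial_mem π U (m := 0) (n := n) (k := n) (by simp) 1

lemma map_mem_covDegree (π : A →⋆ₐ[ℂ] B) (U : B) (a : A) : π a ∈ covDegree π U 0 := by
  simpa [covMonomial] using covMonomial_mem π U (m := 0) (n := 0) (k := 0) (by simp) a

lemma star_mem_covDegree {π : A →⋆ₐ[ℂ] B} {U : B} {k : ℤ} {x : B} (hx : x ∈ covDegree π U k) :
    star x ∈ covDegree π U (-k) := by
  induction hx using Submodule.span_induction with
  | mem x hx =>
    obtain ⟨m, a, n, hk, rfl⟩ := hx
    rw [star_covMonomial]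
    exact covMonomial_mem π U (by omega) _
  | zero => simp
  | add x y _ _ hx hy => rw [star_add]; exact add_mem hx hy
  | smul c x _ hx => rw [star_smul]; exact Submodule.smul_mem _ _ hx

lemma norm_le_one_of_mul_star_mul {V : B} (hV : V * star V * V = V) : ‖V‖ ≤ 1 := by
  have hp : IsStarProjection (star V * V) :=
    ⟨by rw [IsIdempotentElem, mul_assoc, ← mul_assoc V, hV], IsSelfAdjoint.star_mul_self V⟩
  have h1 := hp.norm_le
  rw [CStarRing.norm_star_mul_self] at h1
  nlinarith [norm_nonneg V]

namespace IsCovariantPair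

variable {δ : A →⋆ₙₐ[ℂ] A} {π : A →⋆ₐ[ℂ] B} {U : B} (h : IsCovariantPair δ π U)

include h

lemma mul_map (a : A) : U * π a = π (δ a) * U := by
  calc U * π a = U * (star U * U * π a) := by rw [← mul_assoc, ← mul_assoc, h.mul_star_mul]
    _ = U * π a * star U * U := by rw [h.commute]; simp only [mul_assoc]
    _ = π (δ a) * U := by rw [h.conj]

lemma map_mul_star (a : A) : π a * star U = star U * π (δ a) := by
  simpa only [star_mul, map_star, star_star] using congrArg star (h.mul_map (star a))

lemma pow_mul_map (n : ℕ) (a : A) : U ^ n * π a = π ((⇑δ)^[n] a) * U ^ n := by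
  induction n generalizing a with
  | zero => simp
  | succ n ih =>
    rw [pow_succ, mul_assoc, h.mul_map, ← mul_assoc, ih, mul_assoc, Function.iterate_succ_apply]

lemma map_mul_star_pow (n : ℕ) (a : A) : π a * star U ^ n = star U ^ n * π ((⇑δ)^[n] a) := by
  induction n generalizing a with
  | zero => simp
  | succ n ih =>
    rw [pow_succ', ← mul_assoc, h.map_mul_star, mul_assoc, ih, ← mul_assoc,
      Function.iterate_succ_apply]

lemma pow_mul_star_pow (n : ℕ) : U ^ n * star U ^ n = π ((⇑δ)^[n] 1) := by
  induction n with
  | zero => simp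
  | succ n ih =>
    rw [Function.iterate_succ_apply', ← h.conj, ← ih, pow_succ', pow_succ]
    simp only [mul_assoc]

lemma pow_mul_star_pow_mul_pow (n : ℕ) : U ^ n * star U ^ n * U ^ n = U ^ n := by
  rw [h.pow_mul_star_pow, ← h.pow_mul_map, map_one, mul_one]

lemma norm_pow_le_one (n : ℕ) : ‖U ^ n‖ ≤ 1 :=
  norm_le_one_of_mul_star_mul (by rw [star_pow, h.pow_mul_star_pow_mul_pow])

lemma norm_star_pow_le_one (n : ℕ) : ‖star U ^ n‖ ≤ 1 := by
  rw [← star_pow, norm_star]; exact h.norm_pow_le_one n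

lemma covMonomial_reduce (m : ℕ) (a : A) (n : ℕ) :
    covMonomial π U m ((⇑δ)^[m] 1 * a * (⇑δ)^[n] 1) n = covMonomial π U m a n := by
  rw [covMonomial, map_mul, map_mul, ← mul_assoc, ← mul_assoc, ← h.map_mul_star_pow, map_one,
    one_mul, mul_assoc _ (π ((⇑δ)^[n] 1)), ← h.pow_mul_map, map_one, mul_one, covMonomial]

lemma mul_mem_of_mem {k : ℤ} {x : B} (hx : x ∈ covDegree π U k) : U * x ∈ covDegree π U (1 + k) := by
  induction hx using Submodule.span_induction with
  | mem x hx =>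
    obtain ⟨m, a, n, hk, rfl⟩ := hx
    cases m with
    | zero =>
      have : U * covMonomial π U 0 a n = covMonomial π U 0 (δ a) (n + 1) := by
        simp only [covMonomial, pow_zero, one_mul]
        rw [← mul_assoc, h.mul_map, mul_assoc, pow_succ']
      rw [this]
      exact covMonomial_mem π U (by push_cast at hk ⊢; omega) _
    | succ m =>
      have : U * covMonomial π U (m + 1) a n = covMonomial π U m ((⇑δ)^[m] (δ 1) * a) n := by
        have h1 := h.conj 1
        rw [map_one, mul_one] at h1
        simp only [covMonomial, map_mul]
        rw [pow_succ', ← mul_assoc (star U ^ m), ← h.map_mul_star_pow, ← h1]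
        simp only [mul_assoc]
      rw [this]
      exact covMonomial_mem π U (by push_cast at hk ⊢; omega) _
  | zero => simp
  | add x y _ _ hx hy => rw [mul_add]; exact add_mem hx hy
  | smul c x _ hx => rw [mul_smul_comm]; exact Submodule.smul_mem _ _ hx

lemma pow_mul_mem_of_mem (n : ℕ) {k : ℤ} {x : B} (hx : x ∈ covDegree π U k) :
    U ^ n * x ∈ covDegree π U (n + k) := by
  induction n with
  | zero => simpa using hx
  | succ n ih =>
    rw [pow_succ', mul_assoc]
    convert h.mul_mem_of_mem ih using 1
    push_cast; ring_nf

lemma mul_mem {k l : ℤ} {x y : B} (hx : x ∈ covDegree π U k) (hy : y ∈ covDegree π U l) :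
    x * y ∈ covDegree π U (k + l) := by
  induction hx using Submodule.span_induction with
  | mem x hx =>
    obtain ⟨m, a, n, rfl, rfl⟩ := hx
    have hy' := h.pow_mul_mem_of_mem n hy
    rw [covMonomial, mul_assoc]
    generalize U ^ n * y = z at hy'
    induction hy' using Submodule.span_induction with
    | mem z hz =>
      obtain ⟨p, b, q, hk, rfl⟩ := hz
      have : star U ^ m * π a * covMonomial π U p b q =
          covMonomial π U (m + p) ((⇑δ)^[p] a * b) q := by
        rw [covMonomial, covMonomial, map_mul, pow_add, mul_assoc, ← mul_assoc (π a),
          ← mul_assoc (π a), h.map_mul_star_pow]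
        simp only [mul_assoc]
      rw [this]
      exact covMonomial_mem π U (by push_cast; omega) _
    | zero => simp
    | add x y _ _ hx hy => rw [mul_add]; exact add_mem hx hy
    | smul c x _ hx => rw [mul_smul_comm]; exact Submodule.smul_mem _ _ hx
  | zero => simp
  | add x y _ _ hx hy => rw [add_mul]; exact add_mem hx hy
  | smul c x _ hx => rw [smul_mul_assoc]; exact Submodule.smul_mem _ _ hx

lemma mul_mem_iSup {x y : B} (hx : x ∈ ⨆ k, covDegree π U k) (hy : y ∈ ⨆ k, covDegree π U k) :
    x * y ∈ ⨆ k, covDegree π U k := by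
  induction hx using Submodule.iSup_induction' with
  | mem k x hx =>
    induction hy using Submodule.iSup_induction' with
    | mem l y hy => exact Submodule.mem_iSup_of_mem _ (h.mul_mem hx hy)
    | zero => simp
    | add x y _ _ hx hy => rw [mul_add]; exact add_mem hx hy
  | zero => simp
  | add x y _ _ hx hy => rw [add_mul]; exact add_mem hx hy

lemma mem_iSup_of_mem_adjoin {x : B} (hx : x ∈ StarAlgebra.adjoin ℂ (Set.range π ∪ {U})) :
    x ∈ ⨆ k, covDegree π U k := by
  induction hx using StarAlgebra.adjoin_induction with
  | mem x hx =>
    rcases hx with ⟨a, rfl⟩ | rfl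
    · exact Submodule.mem_iSup_of_mem _ (map_mem_covDegree π U a)
    · exact Submodule.mem_iSup_of_mem _ (by simpa using pow_mem_covDegree π x 1)
  | algebraMap r =>
    rw [← AlgHomClass.commutes π]
    exact Submodule.mem_iSup_of_mem _ (map_mem_covDegree π U _)
  | add x y _ _ hx hy => exact add_mem hx hy
  | mul x y _ _ hx hy => exact h.mul_mem_iSup hx hy
  | star x hmem hx =>
    clear hmem
    induction hx using Submodule.iSup_induction' with
    | mem k x hx => exact Submodule.mem_iSup_of_mem _ (star_mem_covDegree hx)
    | zero => simp
    | add x y _ _ hx hy => rw [star_add]; exact add_mem hx hy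

lemma mul_star_pow_mul_pow {n : ℕ} {x : B} (hx : x ∈ covDegree π U n) :
    x * star U ^ n * U ^ n = x := by
  induction hx using Submodule.span_induction with
  | mem x hx =>
    obtain ⟨m, a, l, hk, rfl⟩ := hx
    obtain rfl : l = m + n := by omega
    rw [covMonomial, pow_add]
    simp only [mul_assoc]
    rw [← mul_assoc (U ^ n), h.pow_mul_star_pow_mul_pow]
  | zero => simp
  | add x y _ _ hx hy => simp only [add_mul, hx, hy]
  | smul c x _ hx => simp only [smul_mul_assoc, hx]

lemma star_pow_mul_pow_mul {n : ℕ} {x : B} (hx : x ∈ covDegree π U (-n)) :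
    star U ^ n * (U ^ n * x) = x := by
  have h1 := h.mul_star_pow_mul_pow (by simpa using star_mem_covDegree hx)
  simpa only [star_mul, star_pow, star_star] using congrArg star h1

lemma covMonomial_mul_star_pow {m k : ℕ} {c : A} (hc : c * (⇑δ)^[m + k] 1 = c) :
    covMonomial π U m c (m + k) * star U ^ k = covMonomial π U m c m := by
  conv_rhs => rw [← hc]
  rw [covMonomial, covMonomial, map_mul, Function.iterate_add_apply, pow_add, mul_assoc, mul_assoc,
    mul_assoc, h.pow_mul_star_pow, h.pow_mul_map]
  simp only [mul_assoc]

lemma pow_mul_covMonomial {m k : ℕ} {c : A} (hc : (⇑δ)^[m + k] 1 * c = c) :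
    U ^ k * covMonomial π U (m + k) c m = covMonomial π U m c m := by
  conv_rhs => rw [← hc]
  rw [covMonomial, covMonomial, map_mul, Function.iterate_add_apply, add_comm m k, pow_add,
    ← mul_assoc (star U ^ m), ← h.map_mul_star_pow, ← h.pow_mul_star_pow]
  simp only [mul_assoc]

end IsCovariantPair

end Monomials

/-! ### The map `Ψ` and the conditional expectation -/

section MatrixMap

variable {B : Type*} [CStarAlgebra B]

/-- The map `Ψ : a ↦ Σ_{m,n} U^{*m} π(a_{mn}) U^n` with values in an arbitrary `C*`-algebra. -/
def covPsi (π : A →⋆ₐ[ℂ] B) (U : B) (a : ℕ → ℕ → A) : B :=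
  ∑ᶠ (m : ℕ) (n : ℕ), covMonomial π U m (a m n) n

lemma covPsi_eq_sum (π : A →⋆ₐ[ℂ] B) (U : B) {a : ℕ → ℕ → A} {K : ℕ}
    (hK : ∀ m n, a m n ≠ 0 → m < K ∧ n < K) :
    covPsi π U a = ∑ m ∈ Finset.range K, ∑ n ∈ Finset.range K, covMonomial π U m (a m n) n := by
  have hne : ∀ {m n}, covMonomial π U m (a m n) n ≠ 0 → m < K ∧ n < K := fun {m n} hmn =>
    hK m n fun h0 => hmn (by rw [h0, covMonomial_zero])
  have hin : ∀ m, ∑ᶠ n, covMonomial π U m (a m n) n =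
      ∑ n ∈ Finset.range K, covMonomial π U m (a m n) n := fun m =>
    finsum_eq_sum_of_support_subset _ fun n hn => by simpa using (hne hn).2
  rw [covPsi, finsum_congr hin]
  refine finsum_eq_sum_of_support_subset _ fun m hm => ?_
  obtain ⟨n, -, hn⟩ := Finset.exists_ne_zero_of_sum_ne_zero hm
  simpa using (hne hn).1

lemma MatMem.exists_bound {δ : A →⋆ₙₐ[ℂ] A} {a : ℕ → ℕ → A} (ha : MatMem δ a) :
    ∃ K : ℕ, ∀ m n, a m n ≠ 0 → m < K ∧ n < K := by
  obtain ⟨⟨K, L⟩, hK⟩ := ha.1.bddAbove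
  refine ⟨max K L + 1, fun m n hmn => ?_⟩
  have := hK (show (m, n) ∈ _ from hmn)
  simp only [Prod.mk_le_mk] at this
  omega

lemma Nmat_bound {a : ℕ → ℕ → A} {K : ℕ} (hK : ∀ m n, a m n ≠ 0 → m < K ∧ n < K) {k : ℤ} (m n : ℕ)
    (hmn : Nmat a k m n ≠ 0) : m < K ∧ n < K := by
  by_cases h0 : m = n
  · subst h0
    simp only [Nmat, diagEntry, if_true] at hmn
    split_ifs at hmn
    · have := (hK _ _ hmn).1; omega
    · have := (hK _ _ hmn).2; omega
  · exact absurd (if_neg h0) hmn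

lemma isIdempotentElem_iterate_one (δ : A →⋆ₙₐ[ℂ] A) (n : ℕ) :
    (⇑δ)^[n] 1 * (⇑δ)^[n] 1 = (⇑δ)^[n] 1 := by
  rw [← iterate_map_mul, one_mul]

lemma MatMem.iterate_one_mul {δ : A →⋆ₙₐ[ℂ] A} {a : ℕ → ℕ → A} (ha : MatMem δ a) (i j : ℕ) :
    (⇑δ)^[i] 1 * a i j = a i j := by
  rw [← ha.2 i j]
  simp only [← mul_assoc, isIdempotentElem_iterate_one]

lemma MatMem.mul_iterate_one {δ : A →⋆ₙₐ[ℂ] A} {a : ℕ → ℕ → A} (ha : MatMem δ a) (i j : ℕ) :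
    a i j * (⇑δ)^[j] 1 = a i j := by
  rw [← ha.2 i j, mul_assoc, isIdempotentElem_iterate_one]

lemma Nmat_zero_apply (a : ℕ → ℕ → A) (i j : ℕ) : Nmat a 0 i j = if i = j then a i j else 0 := by
  rw [Nmat]
  split_ifs with hij
  · subst hij; simp [diagEntry]
  · rfl

lemma iterate_one_mul_iterate_add_one (δ : A →⋆ₙₐ[ℂ] A) (m k : ℕ) :
    (⇑δ)^[m] 1 * (⇑δ)^[m + k] 1 = (⇑δ)^[m + k] 1 := by
  rw [Function.iterate_add_apply, ← iterate_map_mul, one_mul]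

lemma iterate_add_one_mul_iterate_one (δ : A →⋆ₙₐ[ℂ] A) (m k : ℕ) :
    (⇑δ)^[m + k] 1 * (⇑δ)^[m] 1 = (⇑δ)^[m + k] 1 := by
  rw [Function.iterate_add_apply, ← iterate_map_mul, mul_one]

lemma MatMem.Nmat {δ : A →⋆ₙₐ[ℂ] A} {a : ℕ → ℕ → A} (ha : MatMem δ a) (k : ℤ) :
    MatMem δ (Nmat a k) := by
  obtain ⟨K, hK⟩ := ha.exists_bound
  refine ⟨((Set.finite_Iio K).prod (Set.finite_Iio K)).subset fun p hp => Nmat_bound hK _ _ hp,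
    fun i j => ?_⟩
  by_cases hij : i = j
  · subst hij
    simp only [_root_.Nmat, if_true, diagEntry]
    split_ifs
    · rw [ha.iterate_one_mul, ← ha.mul_iterate_one i (i + k.toNat), mul_assoc,
        iterate_add_one_mul_iterate_one]
    · rw [mul_assoc, ha.mul_iterate_one, ← ha.iterate_one_mul (i + (-k).toNat) i, ← mul_assoc,
        iterate_one_mul_iterate_add_one]
  · simp [_root_.Nmat, hij]

/-- The matrix with the single entry `δ^m(1) c δ^n(1)` at the position `(m, n)`. -/
def singleEntry (δ : A →⋆ₙₐ[ℂ] A) (m : ℕ) (c : A) (n : ℕ) : ℕ → ℕ → A :=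
  fun i j => if i = m ∧ j = n then (⇑δ)^[m] 1 * c * (⇑δ)^[n] 1 else 0

lemma matMem_singleEntry (δ : A →⋆ₙₐ[ℂ] A) (m : ℕ) (c : A) (n : ℕ) :
    MatMem δ (singleEntry δ m c n) := by
  refine ⟨(Set.finite_singleton (m, n)).subset fun p hp => ?_, fun i j => ?_⟩
  · by_contra hne
    refine hp (if_neg fun h => hne ?_)
    rw [Set.mem_singleton_iff, Prod.ext_iff]
    exact h
  · rw [singleEntry]
    split_ifs with hij
    · obtain ⟨rfl, rfl⟩ := hij
      rw [mul_assoc _ _ ((⇑δ)^[j] 1), mul_assoc _ _ ((⇑δ)^[j] 1), isIdempotentElem_iterate_one]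
      simp only [← mul_assoc, isIdempotentElem_iterate_one]
    · simp

lemma Nmat_singleEntry (δ : A →⋆ₙₐ[ℂ] A) (m : ℕ) (c : A) (n : ℕ) :
    Nmat (singleEntry δ m c n) 0 = if m = n then singleEntry δ m c n else 0 := by
  funext i j
  rw [Nmat_zero_apply]
  split_ifs with hij hmn hmn
  · rfl
  · exact if_neg fun h => hmn (by omega)
  · exact (if_neg fun h => hij (by omega)).symm
  · rfl

/-- The linear space `M(A)`. -/
def matSubmodule (δ : A →⋆ₙₐ[ℂ] A) : Submodule ℂ (ℕ → ℕ → A) where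
  carrier := {a | MatMem δ a}
  zero_mem' := ⟨by simp, by simp⟩
  add_mem' {a b} ha hb := by
    refine ⟨(ha.1.union hb.1).subset fun p hp => ?_, fun i j => ?_⟩
    · by_contra hne
      simp only [Set.mem_union, Set.mem_ofPred_eq, not_or, not_not] at hne
      exact hp (by simp [hne])
    · simp only [Pi.add_apply, mul_add, add_mul, ha.2 i j, hb.2 i j]
  smul_mem' c a ha := by
    refine ⟨ha.1.subset fun p hp hp0 => hp (by simp [hp0]), fun i j => ?_⟩
    simp only [Pi.smul_apply, mul_smul_comm, smul_mul_assoc, ha.2 i j]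

/-- The map `Ψ` as a linear map on `M(A)`. -/
def covPsiLin (δ : A →⋆ₙₐ[ℂ] A) (π : A →⋆ₐ[ℂ] B) (U : B) : matSubmodule δ →ₗ[ℂ] B where
  toFun a := covPsi π U a.1
  map_add' a b := by
    obtain ⟨K, hK⟩ := MatMem.exists_bound a.2
    obtain ⟨L, hL⟩ := MatMem.exists_bound b.2
    have ha : ∀ m n, a.1 m n ≠ 0 → m < max K L ∧ n < max K L := fun m n h => by
      have := hK m n h; omega
    have hb : ∀ m n, b.1 m n ≠ 0 → m < max K L ∧ n < max K L := fun m n h => by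
      have := hL m n h; omega
    have hab : ∀ m n, (a + b).1 m n ≠ 0 → m < max K L ∧ n < max K L := fun m n h => by
      by_cases h0 : a.1 m n = 0
      · exact hb m n fun h1 => h (by simp [h0, h1])
      · exact ha m n h0
    rw [covPsi_eq_sum π U ha, covPsi_eq_sum π U hb, covPsi_eq_sum π U hab]
    simp only [← Finset.sum_add_distrib, covMonomial, Submodule.coe_add, Pi.add_apply, map_add,
      mul_add, add_mul]
  map_smul' c a := by
    obtain ⟨K, hK⟩ := MatMem.exists_bound a.2
    have hca : ∀ m n, (c • a).1 m n ≠ 0 → m < K ∧ n < K := fun m n h =>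
      hK m n fun h1 => h (by simp [h1])
    rw [covPsi_eq_sum π U hK, covPsi_eq_sum π U hca]
    simp only [Finset.smul_sum, covMonomial, Submodule.coe_smul, Pi.smul_apply, map_smul,
      mul_smul_comm, smul_mul_assoc, RingHom.id_apply]

/-- The map deleting all entries away from the main diagonal, as a linear map on `M(A)`. -/
def diagLin (δ : A →⋆ₙₐ[ℂ] A) : matSubmodule δ →ₗ[ℂ] matSubmodule δ where
  toFun a := ⟨Nmat a.1 0, MatMem.Nmat a.2 0⟩
  map_add' a b := by
    ext i j
    simp only [Submodule.coe_add, Pi.add_apply, Nmat_zero_apply]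
    split_ifs <;> simp
  map_smul' c a := by
    ext i j
    simp only [Submodule.coe_smul, Pi.smul_apply, Nmat_zero_apply, RingHom.id_apply]
    split_ifs <;> simp

namespace IsCovariantPair

variable {δ : A →⋆ₙₐ[ℂ] A} {π : A →⋆ₐ[ℂ] B} {U : B} (h : IsCovariantPair δ π U)

include h

lemma covPsi_singleEntry (m : ℕ) (c : A) (n : ℕ) :
    covPsi π U (singleEntry δ m c n) = covMonomial π U m c n := by
  rw [covPsi, finsum_eq_single _ m, finsum_eq_single _ n]
  · rw [singleEntry, if_pos ⟨rfl, rfl⟩, h.covMonomial_reduce]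
  · intro j hj
    rw [singleEntry, if_neg (fun h => hj h.2), covMonomial_zero]
  · intro i hi
    simp only [singleEntry, if_neg (fun h => hi (And.left h)), covMonomial_zero, finsum_zero]

lemma iSup_covDegree_le : ⨆ k, covDegree π U k ≤ LinearMap.range (covPsiLin δ π U) := by
  refine iSup_le fun k => Submodule.span_le.2 ?_
  rintro _ ⟨m, a, n, -, rfl⟩
  exact ⟨⟨_, matMem_singleEntry δ m a n⟩, h.covPsi_singleEntry m a n⟩

/-- Property `(*)` yields a contractive projection onto the elements of degree zero. -/
lemma exists_expectation
    (hstar : ∀ a, MatMem δ a → ‖covPsi π U (Nmat a 0)‖ ≤ ‖covPsi π U a‖)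
    (hd : Dense (StarAlgebra.adjoin ℂ (Set.range π ∪ {U}) : Set B)) :
    ∃ E : B →L[ℂ] B, (∀ x, ‖E x‖ ≤ ‖x‖) ∧
      (∀ m c n, E (covMonomial π U m c n) = if m = n then covMonomial π U m c n else 0) := by
  have hdr : DenseRange (covPsiLin δ π U) :=
    hd.mono fun x hx => h.iSup_covDegree_le (h.mem_iSup_of_mem_adjoin hx)
  have hn : ∀ a, ‖(covPsiLin δ π U ∘ₗ diagLin δ) a‖ ≤ 1 * ‖covPsiLin δ π U a‖ := fun a => by
    rw [one_mul]; exact hstar a.1 a.2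
  refine ⟨(covPsiLin δ π U ∘ₗ diagLin δ).extendOfNorm (covPsiLin δ π U), fun x => ?_,
    fun m c n => ?_⟩
  · simpa using LinearMap.norm_extendOfNorm_apply_le hdr 1 hn x
  · have h1 := LinearMap.extendOfNorm_eq hdr ⟨1, hn⟩ ⟨_, matMem_singleEntry δ m c n⟩
    have h2 : (covPsiLin δ π U ∘ₗ diagLin δ) ⟨_, matMem_singleEntry δ m c n⟩ =
        covPsi π U (Nmat (singleEntry δ m c n) 0) := rfl
    rw [h2, Nmat_singleEntry] at h1
    rw [← h.covPsi_singleEntry m c n]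
    refine h1.trans ?_
    split_ifs
    · rfl
    · exact map_zero (covPsiLin δ π U)

end IsCovariantPair

/-- The map `𝒩_k`, expressed through a given expectation `E`: it is `x ↦ E (x U^{*k})` for
`k ≥ 0` and `x ↦ E (U^{-k} x)` for `k < 0`. -/
def covN (E : B →L[ℂ] B) (U : B) : ℤ → B →L[ℂ] B
  | Int.ofNat n => E.comp ((ContinuousLinearMap.mul ℂ B).flip (star U ^ n))
  | Int.negSucc n => E.comp (ContinuousLinearMap.mul ℂ B (U ^ (n + 1)))

/-- The projection onto the elements of degree `k`, expressed through an expectation `E`. -/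
def covP (E : B →L[ℂ] B) (U : B) : ℤ → B →L[ℂ] B
  | Int.ofNat n => ((ContinuousLinearMap.mul ℂ B).flip (U ^ n)).comp (covN E U n)
  | Int.negSucc n => (ContinuousLinearMap.mul ℂ B (star U ^ (n + 1))).comp
      (covN E U (Int.negSucc n))

lemma covN_ofNat (E : B →L[ℂ] B) (U : B) (n : ℕ) (x : B) :
    covN E U (Int.ofNat n) x = E (x * star U ^ n) := rfl

lemma covN_negSucc (E : B →L[ℂ] B) (U : B) (n : ℕ) (x : B) :
    covN E U (Int.negSucc n) x = E (U ^ (n + 1) * x) := rfl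

lemma covP_ofNat (E : B →L[ℂ] B) (U : B) (n : ℕ) (x : B) :
    covP E U (Int.ofNat n) x = E (x * star U ^ n) * U ^ n := rfl

lemma covP_negSucc (E : B →L[ℂ] B) (U : B) (n : ℕ) (x : B) :
    covP E U (Int.negSucc n) x = star U ^ (n + 1) * E (U ^ (n + 1) * x) := rfl

lemma norm_mul_le_of_left {x y : B} (hx : ‖x‖ ≤ 1) : ‖x * y‖ ≤ ‖y‖ :=
  (norm_mul_le x y).trans (mul_le_of_le_one_left (norm_nonneg y) hx)

lemma norm_mul_le_of_right {x y : B} (hy : ‖y‖ ≤ 1) : ‖x * y‖ ≤ ‖x‖ :=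
  (norm_mul_le x y).trans (mul_le_of_le_one_right (norm_nonneg x) hy)

lemma map_covDegree {π : A →⋆ₐ[ℂ] B} {U : B} {E : B →L[ℂ] B}
    (hE : ∀ m c n, E (covMonomial π U m c n) = if m = n then covMonomial π U m c n else 0)
    {k : ℤ} {x : B} (hx : x ∈ covDegree π U k) : E x = if k = 0 then x else 0 := by
  induction hx using Submodule.span_induction with
  | mem x hx =>
    obtain ⟨m, c, n, rfl, rfl⟩ := hx
    rw [hE]
    exact if_congr (by omega) rfl rfl
  | zero => simp
  | add x y _ _ hx hy => rw [map_add, hx, hy]; split_ifs <;> simp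
  | smul c x _ hx => rw [map_smul, hx]; split_ifs <;> simp

namespace IsCovariantPair

variable {δ : A →⋆ₙₐ[ℂ] A} {π : A →⋆ₐ[ℂ] B} {U : B} (h : IsCovariantPair δ π U)
  {E : B →L[ℂ] B}
  (hE : ∀ m c n, E (covMonomial π U m c n) = if m = n then covMonomial π U m c n else 0)

include h in
lemma norm_covN_le (hn : ∀ x, ‖E x‖ ≤ ‖x‖) (k : ℤ) (x : B) : ‖covN E U k x‖ ≤ ‖x‖ := by
  cases k with
  | ofNat n =>
    rw [covN_ofNat]; exact (hn _).trans (norm_mul_le_of_right (h.norm_star_pow_le_one n))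
  | negSucc n =>
    rw [covN_negSucc]; exact (hn _).trans (norm_mul_le_of_left (h.norm_pow_le_one _))

include h in
lemma norm_covP_le (k : ℤ) (x : B) : ‖covP E U k x‖ ≤ ‖covN E U k x‖ := by
  cases k with
  | ofNat n =>
    rw [covP_ofNat, covN_ofNat]; exact norm_mul_le_of_right (h.norm_pow_le_one n)
  | negSucc n =>
    rw [covP_negSucc, covN_negSucc]; exact norm_mul_le_of_left (h.norm_star_pow_le_one _)

include h hE in
lemma covP_apply {k l : ℤ} {x : B} (hx : x ∈ covDegree π U l) :
    covP E U k x = if l = k then x else 0 := by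
  have hs : ∀ n : ℕ, star U ^ n ∈ covDegree π U (-n) := fun n => by
    simpa using star_mem_covDegree (pow_mem_covDegree π U n)
  cases k with
  | ofNat n =>
    rw [covP_ofNat, map_covDegree hE (h.mul_mem hx (hs n))]
    by_cases hl : l = n
    · subst hl
      rw [if_pos (by omega), h.mul_star_pow_mul_pow hx]
      simp
    · rw [if_neg (by omega), zero_mul, if_neg (by simpa using hl)]
  | negSucc n =>
    rw [covP_negSucc, map_covDegree hE (h.mul_mem (pow_mem_covDegree π U _) hx)]
    by_cases hl : l = Int.negSucc n
    · rw [if_pos (by omega), if_pos hl]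
      refine h.star_pow_mul_pow_mul ?_
      rwa [show -((n + 1 : ℕ) : ℤ) = Int.negSucc n by omega, ← hl]
    · rw [if_neg (by omega), mul_zero, if_neg hl]

include h hE in
lemma covN_covPsi {a : ℕ → ℕ → A} (ha : MatMem δ a) (k : ℤ) :
    covN E U k (covPsi π U a) = covPsi π U (Nmat a k) := by
  obtain ⟨K, hK⟩ := ha.exists_bound
  have hs : ∀ n : ℕ, star U ^ n ∈ covDegree π U (-n) := fun n => by
    simpa using star_mem_covDegree (pow_mem_covDegree π U n)
  rw [covPsi_eq_sum π U hK, covPsi_eq_sum π U (Nmat_bound hK)]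
  cases k with
  | ofNat k =>
    rw [covN_ofNat, Finset.sum_mul, map_sum]
    refine Finset.sum_congr rfl fun m hm => ?_
    have h1 : ∀ n, E (covMonomial π U m (a m n) n * star U ^ k) =
        if n = m + k then covMonomial π U m (a m n) m else 0 := fun n => by
      split_ifs with hnk
      · subst hnk
        rw [h.covMonomial_mul_star_pow (ha.mul_iterate_one _ _), hE, if_pos rfl]
      · rw [map_covDegree hE (h.mul_mem (covMonomial_mem π U rfl _) (hs k)), if_neg (by omega)]
    rw [Finset.sum_mul, map_sum, Finset.sum_congr rfl fun n _ => h1 n, Finset.sum_ite_eq',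
      Finset.sum_eq_single_of_mem m hm]
    · split_ifs with hmk
      · simp [Nmat, diagEntry]
      · have h0 : a m (m + k) = 0 := by
          by_contra h0
          exact hmk (Finset.mem_range.2 (hK _ _ h0).2)
        simp [Nmat, diagEntry, h0]
    · intro n _ hmn
      simp [Nmat, hmn.symm]
  | negSucc k =>
    rw [covN_negSucc, Finset.sum_comm, Finset.mul_sum, map_sum]
    refine Finset.sum_congr rfl fun n hnK => ?_
    have h1 : ∀ m, E (U ^ (k + 1) * covMonomial π U m (a m n) n) =
        if m = n + (k + 1) then covMonomial π U n (a m n) n else 0 := fun m => by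
      split_ifs with hnk
      · subst hnk
        rw [h.pow_mul_covMonomial (ha.iterate_one_mul _ _), hE, if_pos rfl]
      · rw [map_covDegree hE (h.mul_mem (pow_mem_covDegree π U _) (covMonomial_mem π U rfl _)),
          if_neg (by push_cast; omega)]
    have hneg : ¬ (0 ≤ Int.negSucc k) := by omega
    have hnat : (-Int.negSucc k).toNat = k + 1 := by omega
    rw [Finset.mul_sum, map_sum, Finset.sum_congr rfl fun n _ => h1 n, Finset.sum_ite_eq',
      Finset.sum_eq_single_of_mem n hnK]
    · split_ifs with hmk
      · simp only [Nmat, diagEntry, if_true, if_neg hneg, hnat]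
      · have h0 : a (n + (k + 1)) n = 0 := by
          by_contra h0
          exact hmk (Finset.mem_range.2 (hK _ _ h0).1)
        simp only [Nmat, diagEntry, if_true, if_neg hneg, hnat, h0, covMonomial_zero]
    · intro m _ hmn
      simp [Nmat, hmn.symm]

include h in
/-- The maps `𝒩_k` on a `C*`-algebra generated by a covariant pair with property `(*)`. -/
theorem exists_covN
    (hstar : ∀ a, MatMem δ a → ‖covPsi π U (Nmat a 0)‖ ≤ ‖covPsi π U a‖)
    (hd : Dense (StarAlgebra.adjoin ℂ (Set.range π ∪ {U}) : Set B)) :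
    ∃ N : ℤ → B →L[ℂ] B, (∀ k a, MatMem δ a → N k (covPsi π U a) = covPsi π U (Nmat a k)) ∧
      (∀ k x, ‖N k x‖ ≤ ‖x‖) ∧ (∀ x, (∀ k, N k x = 0) → x = 0) ∧
      ∀ x, N 0 (star x * x) = 0 → x = 0 := by
  obtain ⟨E, hn, hE⟩ := h.exists_expectation hstar hd
  have hG : IsGradedProjection (covDegree π U) (covP E U) :=
    { one_mem := by simpa using map_mem_covDegree π U 1
      mul_mem := h.mul_mem
      star_mem := star_mem_covDegree
      dense := hd.mono fun x hx => h.mem_iSup_of_mem_adjoin hx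
      apply_same := fun hx => by rw [h.covP_apply hE hx, if_pos rfl]
      apply_ne := fun hx hl => by rw [h.covP_apply hE hx, if_neg hl]
      norm_apply_le := fun k x => (h.norm_covP_le k x).trans (h.norm_covN_le hn k x) }
  have h0 : ∀ {k x}, covN E U k x = 0 → covP E U k x = 0 := fun {k x} hx =>
    norm_le_zero_iff.1 ((h.norm_covP_le k x).trans (by rw [hx, norm_zero]))
  refine ⟨covN E U, fun k a ha => h.covN_covPsi hE ha k, h.norm_covN_le hn,
    fun x hx => hG.eq_zero_of_apply_eq_zero fun k => h0 (hx k),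
    fun x hx => hG.eq_zero_of_apply_eq_zero fun k => ?_⟩
  have h1 := hG.norm_apply_sq_le k x
  rw [h0 hx, norm_zero] at h1
  exact norm_eq_zero.1 (pow_eq_zero_iff two_ne_zero |>.1 (le_antisymm h1 (sq_nonneg _)))

end IsCovariantPair

end MatrixMap

/-! ### Transport to a `C*`-subalgebra -/

section Transport

/-- On the main diagonal the double sum defining `Ψ` collapses to a single sum. -/
lemma covPsi_Nmat_zero {B : Type*} [CStarAlgebra B] (π : A →⋆ₐ[ℂ] B) (U : B) (a : ℕ → ℕ → A) :
    covPsi π U (Nmat a 0) = ∑ᶠ m : ℕ, star U ^ m * π (a m m) * U ^ m := by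
  refine finsum_congr fun m => ?_
  rw [finsum_eq_single _ m fun n hn => by rw [Nmat_zero_apply, if_neg hn.symm, covMonomial_zero],
    Nmat_zero_apply, if_pos rfl, covMonomial]

lemma map_covPsi {B C : Type*} [CStarAlgebra B] [CStarAlgebra C] (f : B →⋆ₐ[ℂ] C)
    (δ : A →⋆ₙₐ[ℂ] A) (π : A →⋆ₐ[ℂ] B) (U : B) {a : ℕ → ℕ → A} (ha : MatMem δ a) :
    f (covPsi π U a) = covPsi (f.comp π) (f U) a := by
  obtain ⟨K, hK⟩ := ha.exists_bound
  rw [covPsi_eq_sum π U hK, covPsi_eq_sum _ _ hK]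
  simp only [map_sum, covMonomial, map_mul, map_pow, map_star, StarAlgHom.comp_apply]

end Transport

/-- If `(π,U,H)` possesses property `(*)`, the contractions `𝒩_k`
extend uniquely from `C*₀(π(A),U)` to bounded linear maps on `C*(π(A),U)`, and for
`a ∈ C*(π(A),U)` the following are equivalent: (i) `a = 0`; (ii) `𝒩_k(a) = 0` for all
`k ∈ ℤ`; (iii) `𝒩₀(a* a) = 0`. -/
theorem Nk_extension_and_vanishing {A : Type*} [CStarAlgebra A] (δ : A →⋆ₙₐ[ℂ] A)
    {H : Type*} [NormedAddCommGroup H] [InnerProductSpace ℂ H] [CompleteSpace H]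
    (π : A →⋆ₐ[ℂ] (H →L[ℂ] H)) (U : H →L[ℂ] H)
    (hrep : IsCovariantRep δ π U) (hstar : PropertyStar δ π U) :
    ∃ N : ℤ → (H →L[ℂ] H) → (H →L[ℂ] H),
      (∀ k : ℤ,
        (∀ a : ℕ → ℕ → A, MatMem δ a → N k (Psi π U a) = Psi π U (Nmat a k)) ∧
        (∀ x ∈ ((StarAlgebra.adjoin ℂ (Set.range ⇑π ∪ {U})).topologicalClosure :
            Set (H →L[ℂ] H)),
          ∀ y ∈ ((StarAlgebra.adjoin ℂ (Set.range ⇑π ∪ {U})).topologicalClosure :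
            Set (H →L[ℂ] H)), N k (x + y) = N k x + N k y) ∧
        (∀ (z : ℂ),
          ∀ x ∈ ((StarAlgebra.adjoin ℂ (Set.range ⇑π ∪ {U})).topologicalClosure :
            Set (H →L[ℂ] H)), N k (z • x) = z • N k x) ∧
        (∀ x ∈ ((StarAlgebra.adjoin ℂ (Set.range ⇑π ∪ {U})).topologicalClosure :
            Set (H →L[ℂ] H)), ‖N k x‖ ≤ ‖x‖) ∧
        ContinuousOn (N k)
          ((StarAlgebra.adjoin ℂ (Set.range ⇑π ∪ {U})).topologicalClosure :
            Set (H →L[ℂ] H)) ∧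
        (∀ g : (H →L[ℂ] H) → (H →L[ℂ] H),
          ContinuousOn g
            ((StarAlgebra.adjoin ℂ (Set.range ⇑π ∪ {U})).topologicalClosure :
              Set (H →L[ℂ] H)) →
          (∀ a : ℕ → ℕ → A, MatMem δ a → g (Psi π U a) = Psi π U (Nmat a k)) →
          Set.EqOn g (N k)
            ((StarAlgebra.adjoin ℂ (Set.range ⇑π ∪ {U})).topologicalClosure :
              Set (H →L[ℂ] H)))) ∧
      (∀ x ∈ ((StarAlgebra.adjoin ℂ (Set.range ⇑π ∪ {U})).topologicalClosure :
          Set (H →L[ℂ] H)),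
        ((x = 0 ↔ ∀ k : ℤ, N k x = 0) ∧ (x = 0 ↔ N 0 (star x * x) = 0))) := by
  have hcov : IsCovariantPair δ π U := ⟨hrep.2.1, hrep.2.2.1, hrep.2.2.2⟩
  set T := StarAlgebra.adjoin ℂ (Set.range ⇑π ∪ {U}) with hT
  have hclosed : IsClosed (T.topologicalClosure : Set (H →L[ℂ] H)) :=
    StarSubalgebra.isClosed_topologicalClosure _
  have hsub := StarSubalgebra.le_topologicalClosure T
  have hπ : ∀ a, π a ∈ T.topologicalClosure :=
    fun a => hsub (StarAlgebra.subset_adjoin ℂ _ (Or.inl ⟨a, rfl⟩))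
  have hU : U ∈ T.topologicalClosure := hsub (StarAlgebra.subset_adjoin ℂ _ (Or.inr rfl))
  let ρ := π.codRestrict T.topologicalClosure hπ
  let V : T.topologicalClosure := ⟨U, hU⟩
  have hρ : IsCovariantPair δ ρ V :=
    ⟨Subtype.ext hcov.1, fun a => Subtype.ext (hcov.2 a), fun a => Subtype.ext (hcov.3 a)⟩
  have hcoe : ∀ a, MatMem δ a → ((covPsi ρ V a : T.topologicalClosure) : H →L[ℂ] H) = Psi π U a :=
    fun a ha => map_covPsi T.topologicalClosure.subtype δ ρ V ha
  have himage : T.topologicalClosure.subtype '' (Set.range ρ ∪ {V}) = Set.range π ∪ {U} := by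
    rw [Set.image_union, Set.image_singleton, ← Set.range_comp]
    rfl
  have hdense : Dense (StarAlgebra.adjoin ℂ (Set.range ρ ∪ {V}) : Set T.topologicalClosure) := by
    have h1 := StarAlgHom.map_adjoin T.topologicalClosure.subtype (Set.range ρ ∪ {V})
    rw [himage, ← hT] at h1
    have h2 : ((↑) : T.topologicalClosure → H →L[ℂ] H) ''
        (StarAlgebra.adjoin ℂ (Set.range ρ ∪ {V}) : Set T.topologicalClosure) = T :=
      congrArg SetLike.coe h1
    exact Subtype.dense_iff.2
      ((StarSubalgebra.topologicalClosure_coe T).le.trans (closure_mono h2.ge))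
  have hstar' : ∀ a, MatMem δ a → ‖covPsi ρ V (Nmat a 0)‖ ≤ ‖covPsi ρ V a‖ := fun a ha => by
    have h1 := hstar a ha
    rwa [← hcoe a ha, ← covPsi_Nmat_zero,
      show covPsi π U (Nmat a 0) = _ from (hcoe _ (ha.Nmat 0)).symm] at h1
  obtain ⟨N, hNPsi, hNnorm, hNall, hNzero⟩ := hρ.exists_covN hstar' hdense
  classical
  let M : ℤ → (H →L[ℂ] H) → (H →L[ℂ] H) := fun k x =>
    if hx : x ∈ T.topologicalClosure then (N k ⟨x, hx⟩ : H →L[ℂ] H) else 0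
  have hM : ∀ k (x : T.topologicalClosure), M k x = N k x := fun k x => dif_pos x.2
  have hMPsi : ∀ k a, MatMem δ a → M k (Psi π U a) = Psi π U (Nmat a k) := fun k a ha => by
    rw [← hcoe a ha, hM, hNPsi k a ha, hcoe _ (ha.Nmat k)]
  have hMcont : ∀ k, ContinuousOn (M k) T.topologicalClosure := fun k => by
    rw [continuousOn_iff_continuous_domRestrict]
    exact (continuous_subtype_val.comp (N k).continuous).congr fun x => (hM k x).symm
  have hMzero : ∀ k (x : T.topologicalClosure), M k x = 0 ↔ N k x = 0 := fun k x => by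
    rw [hM, ZeroMemClass.coe_eq_zero]
  refine ⟨M, fun k => ⟨hMPsi k, ?_, ?_, ?_, hMcont k, ?_⟩, ?_⟩
  · intro x hx y hy
    lift x to T.topologicalClosure using hx
    lift y to T.topologicalClosure using hy
    exact (hM k (x + y)).trans (by simp [hM])
  · intro z x hx
    lift x to T.topologicalClosure using hx
    exact (hM k (z • x)).trans (by simp [hM])
  · intro x hx
    lift x to T.topologicalClosure using hx
    rw [hM]
    exact hNnorm k x
  · intro g hg hgPsi
    have hEq : Set.EqOn g (M k) (Psi π U '' {a | MatMem δ a}) := by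
      rintro _ ⟨a, ha, rfl⟩
      rw [hgPsi a ha, hMPsi k a ha]
    refine hEq.of_subset_closure hg (hMcont k) ?_ ?_
    · rintro _ ⟨a, ha, rfl⟩
      rw [← hcoe a ha]
      exact Subtype.property _
    · rw [StarSubalgebra.topologicalClosure_coe]
      refine closure_mono fun x hx => ?_
      obtain ⟨a, rfl⟩ := hcov.iSup_covDegree_le (hcov.mem_iSup_of_mem_adjoin hx)
      exact ⟨a.1, a.2, rfl⟩
  · intro x hx
    lift x to T.topologicalClosure using hx
    have h0 : M 0 (star (x : H →L[ℂ] H) * x) = 0 ↔ N 0 (star x * x) = 0 := hMzero 0 (star x * x)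
    simp only [hMzero, h0, ZeroMemClass.coe_eq_zero]
    exact ⟨⟨fun hx k => by rw [hx, map_zero], hNall x⟩,
      ⟨fun hx => by rw [hx, mul_zero, map_zero], hNzero x⟩⟩
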